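/- There do not exist a natural number n, an open set U ⊆ ℝⁿ, a point u ∈ U, a real ε > 0, a function q : ℝⁿ → ℝ differentiable at u with q(U) ⊆ [0,1], and a function θ : ℝ → ℝⁿ with θ(1) = u, with θ(t) ∈ U for all t ∈ (1−ε, 1], differentiable at 1 within (−∞, 1], such that q(θ(t)) = t for all t ∈ (1−ε, 1]. (Equivalently: near the endpoint 1, the identity map of [0,1] cannot be factored as a differentiable map into an open subset of a Euclidean space followed by a differentiable map taking values in [0,1].) -/

import Mathlib

/-- Near the endpoint `1`, the identity of `[0,1]` cannot be factored as a
differentiable map into an open subset of a Euclidean space followed by a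
differentiable map with values in `[0,1]`. -/
theorem no_differentiable_factorisation_of_endpoint :
    ¬ ∃ (n : ℕ) (U : Set (EuclideanSpace ℝ (Fin n))) (u : EuclideanSpace ℝ (Fin n))
        (ε : ℝ) (q : EuclideanSpace ℝ (Fin n) → ℝ) (θ : ℝ → EuclideanSpace ℝ (Fin n)),
      IsOpen U ∧ u ∈ U ∧ 0 < ε ∧
      DifferentiableAt ℝ q u ∧ q '' U ⊆ Set.Icc (0 : ℝ) 1 ∧
      θ 1 = u ∧ (∀ t ∈ Set.Ioc (1 - ε) 1, θ t ∈ U) ∧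
      DifferentiableWithinAt ℝ θ (Set.Iic 1) 1 ∧
      (∀ t ∈ Set.Ioc (1 - ε) 1, q (θ t) = t) := by
  rintro ⟨n, U, u, ε, q, θ, hU, hu, hε, hq, hqU, rfl, -, hθ, hqθ⟩
  have h_one : q (θ 1) = 1 := hqθ 1 ⟨by linarith, le_rfl⟩
  have h_max : IsLocalMax q (θ 1) := by
    filter_upwards [hU.mem_nhds hu] with x hx
    rw [h_one]
    exact (hqU ⟨x, hx, rfl⟩).2
  have h_zero : HasFDerivAt q (0 : EuclideanSpace ℝ (Fin n) →L[ℝ] ℝ) (θ 1) :=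
    h_max.fderiv_eq_zero ▸ hq.hasFDerivAt
  have h_comp : HasDerivWithinAt (q ∘ θ) 0 (Set.Iic 1) 1 := by
    simpa using h_zero.comp_hasDerivWithinAt 1 hθ.hasDerivWithinAt
  have h_eq : id =ᶠ[nhdsWithin 1 (Set.Iic 1)] q ∘ θ := by
    filter_upwards [Ioc_mem_nhdsLE (show 1 - ε < 1 by linarith)] with t ht
    exact (hqθ t ht).symm
  have h_id : HasDerivWithinAt (id : ℝ → ℝ) 0 (Set.Iic 1) 1 :=
    h_comp.congr_of_eventuallyEq h_eq h_one.symm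
  exact one_ne_zero ((uniqueDiffWithinAt_Iic (1 : ℝ)).eq_deriv _
    (hasDerivWithinAt_id 1 (Set.Iic 1)) h_id)
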